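/- Let n ≥ 1, let e₁, …, eₙ denote the standard basis vectors of ℝⁿ, and let K₁, …, Kₙ be nonempty compact connected subsets of ℝⁿ such that 0 ∈ Kᵢ and eᵢ ∈ Kᵢ for every i. Let δ ≥ 0 be such that ‖x‖_∞ ≤ δ for every x in K₁ ∪ ⋯ ∪ Kₙ (‖·‖_∞ being the sup-norm), and let s, l be positive integers with l > s + (n−1)δ. Let Z = {z ∈ ℤⁿ : |zᵢ| ≤ l for all i}. Then the cube [−s, s]ⁿ is contained in K₁ + ⋯ + Kₙ + Z. -/

import Mathlib

open Pointwise

/-- The Minkowski sum `K 0 + ⋯ + K (n-1)` of a family of sets. -/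
def familySum {n : ℕ} {X : Type*} [AddCommMonoid X] (K : Fin n → Set X) : Set X :=
  {x | ∃ f : Fin n → X, (∀ i, f i ∈ K i) ∧ ∑ i, f i = x}

/-- The `k`-th vertex of the simplex of the Kuhn triangulation of `ℤⁿ` with least vertex `p`
whose successive edges point in the directions `σ 0, σ 1, …`. -/
def kuhnVertex {n : ℕ} (p : Fin n → ℤ) (σ : Equiv.Perm (Fin n)) (k : Fin (n + 1)) : Fin n → ℤ :=
  fun j => p j + if (σ.symm j : ℕ) < k then 1 else 0

lemma le_kuhnVertex {n : ℕ} (p : Fin n → ℤ) (σ : Equiv.Perm (Fin n)) (k : Fin (n + 1))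
    (j : Fin n) : p j ≤ kuhnVertex p σ k j := by
  unfold kuhnVertex
  split_ifs <;> simp

lemma kuhnVertex_le {n : ℕ} (p : Fin n → ℤ) (σ : Equiv.Perm (Fin n)) (k : Fin (n + 1))
    (j : Fin n) : kuhnVertex p σ k j ≤ p j + 1 := by
  unfold kuhnVertex
  split_ifs <;> simp

lemma kuhnVertex_mul_swap {m : ℕ} (p : Fin (m + 1) → ℤ) (σ : Equiv.Perm (Fin (m + 1)))
    (a : Fin m) (k : Fin (m + 2)) (hk : k ≠ a.castSucc.succ) :
    kuhnVertex p (σ * Equiv.swap a.castSucc a.succ) k = kuhnVertex p σ k := by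
  have hk' : (k : ℕ) ≠ a + 1 := fun h => hk (Fin.ext (by simpa using h))
  funext j
  unfold kuhnVertex
  congr 1
  have e : (σ * Equiv.swap a.castSucc a.succ).symm j
      = Equiv.swap a.castSucc a.succ (σ.symm j) := by
    simp [Equiv.Perm.mul_def]
  rw [e]
  refine if_congr ?_ rfl rfl
  rw [Equiv.swap_apply_def]
  split_ifs with h₁ h₂
  · rw [h₁]; simp; omega
  · rw [h₂]; simp; omega
  · rfl

lemma kuhnVertex_mul_finRotate {m : ℕ} (p : Fin (m + 1) → ℤ) (σ : Equiv.Perm (Fin (m + 1)))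
    (l : Fin (m + 1)) :
    kuhnVertex (p + Pi.single (σ 0) 1) (σ * finRotate (m + 1)) l.castSucc
      = kuhnVertex p σ l.succ := by
  funext j
  obtain ⟨q, rfl⟩ := σ.surjective j
  have e : (σ * finRotate (m + 1)).symm (σ q) = (finRotate (m + 1)).symm q := by
    simp [Equiv.Perm.mul_def]
  unfold kuhnVertex
  rw [e]
  obtain ⟨r, rfl⟩ := (finRotate (m + 1)).surjective q
  simp only [Equiv.symm_apply_apply, Pi.add_apply, Pi.single_apply, σ.injective.eq_iff,
    Fin.val_castSucc, Fin.val_succ]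
  rcases Fin.eq_castSucc_or_eq_last r with ⟨r, rfl⟩ | rfl
  · have : finRotate (m + 1) r.castSucc = r.succ := by
      simp
    rw [this]
    simp [Fin.succ_ne_zero]
  · rw [finRotate_last]
    have : ¬ (m : ℕ) < l := by omega
    simp [this]

/-- The lattice points of the half-open cube `[0, N)ⁿ`. -/
noncomputable def latticeBox (n : ℕ) (N : ℤ) : Finset (Fin n → ℤ) :=
  Fintype.piFinset fun _ => Finset.Ico 0 N

lemma mem_latticeBox_of_face {m : ℕ} {N : ℤ} {g : (Fin (m + 1) → Fin (m + 1) → ℤ) → ℤ}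
    (hg : ∀ w, g w ≠ 0 → ∀ j, (∃ l, 0 < w l j) ∧ ∃ l, w l j < N)
    {p : Fin (m + 1) → ℤ} {σ : Equiv.Perm (Fin (m + 1))} {φ : Fin (m + 1) → Fin (m + 2)}
    (h : g (fun l => kuhnVertex p σ (φ l)) ≠ 0) : p ∈ latticeBox (m + 1) N := by
  simp only [latticeBox, Fintype.mem_piFinset, Finset.mem_Ico]
  intro j
  obtain ⟨⟨l, hl⟩, l', hl'⟩ := hg _ h j
  have h₁ := kuhnVertex_le p σ (φ l) j
  have h₂ := le_kuhnVertex p σ (φ l') j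
  constructor <;> omega

/-- The faces of the simplices of the Kuhn triangulation cancel in pairs. -/
lemma sum_faces_eq_zero {m : ℕ} {N : ℤ} {g : (Fin (m + 1) → Fin (m + 1) → ℤ) → ℤ}
    (hg : ∀ w, g w ≠ 0 → ∀ j, (∃ l, 0 < w l j) ∧ ∃ l, w l j < N) :
    ∑ p ∈ latticeBox (m + 1) N, ∑ σ : Equiv.Perm (Fin (m + 1)), (Equiv.Perm.sign σ : ℤ) *
      ∑ k : Fin (m + 2), (-1) ^ (k : ℕ) * g (fun l => kuhnVertex p σ (k.succAbove l)) = 0 := by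
  have inner : ∀ (p : Fin (m + 1) → ℤ) (a : Fin m),
      ∑ σ : Equiv.Perm (Fin (m + 1)), (Equiv.Perm.sign σ : ℤ) *
        ((-1) ^ (a.castSucc.succ : ℕ) *
          g (fun l => kuhnVertex p σ (a.castSucc.succ.succAbove l))) = 0 := by
    intro p a
    rw [← self_eq_neg, ← Finset.sum_neg_distrib]
    refine Fintype.sum_equiv (Equiv.mulRight (Equiv.swap a.castSucc a.succ)) _ _ fun σ => ?_
    have hne : a.castSucc ≠ a.succ := Fin.castSucc_lt_succ.ne
    simp only [Equiv.coe_mulRight, Equiv.Perm.sign_mul, Equiv.Perm.sign_swap hne,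
      kuhnVertex_mul_swap _ _ _ _ (Fin.succAbove_ne _ _)]
    push_cast
    ring
  have ends : ∑ σ : Equiv.Perm (Fin (m + 1)), ∑ p ∈ latticeBox (m + 1) N,
        (Equiv.Perm.sign σ : ℤ) * g (fun l => kuhnVertex p σ l.succ)
      = ∑ σ : Equiv.Perm (Fin (m + 1)), ∑ p ∈ latticeBox (m + 1) N,
        (Equiv.Perm.sign σ : ℤ) * ((-1) ^ m * g (fun l => kuhnVertex p σ l.castSucc)) := by
    refine Fintype.sum_equiv (Equiv.mulRight (finRotate (m + 1))) _ _ fun σ => ?_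
    simp only [Equiv.coe_mulRight, Equiv.Perm.sign_mul, sign_finRotate]
    have key : ∀ p, (Equiv.Perm.sign σ : ℤ) * g (fun l => kuhnVertex p σ l.succ) =
        ((Equiv.Perm.sign σ * (-1) ^ m : ℤˣ) : ℤ) * ((-1) ^ m *
          g (fun l => kuhnVertex (p + Pi.single (σ 0) 1) (σ * finRotate (m + 1)) l.castSucc)) := by
      intro p
      simp only [kuhnVertex_mul_finRotate]
      push_cast
      have : ((-1 : ℤ) ^ m) * (-1) ^ m = 1 := by rw [← mul_pow]; simp
      linear_combination (-(Equiv.Perm.sign σ : ℤ) * g (fun l => kuhnVertex p σ l.succ)) * this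
    refine Finset.sum_bij_ne_zero (fun p _ _ => p + Pi.single (σ 0) 1) ?_ ?_ ?_ ?_
    · intro p _ h
      rw [key p] at h
      exact mem_latticeBox_of_face hg (right_ne_zero_of_mul (right_ne_zero_of_mul h))
    · intro p _ _ q _ _ h
      exact add_right_cancel h
    · intro p _ h
      have h' : (Equiv.Perm.sign σ : ℤ) *
          g (fun l => kuhnVertex (p - Pi.single (σ 0) 1) σ l.succ) ≠ 0 := by
        rw [key, sub_add_cancel]; exact h
      exact ⟨p - Pi.single (σ 0) 1, mem_latticeBox_of_face hg (right_ne_zero_of_mul h'), h',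
        sub_add_cancel _ _⟩
    · intro p _ _
      exact key p
  simp only [Fin.sum_univ_succ (n := m + 1), Fin.sum_univ_castSucc (n := m), mul_add,
    Finset.sum_add_distrib, Finset.mul_sum]
  have mid : ∑ p ∈ latticeBox (m + 1) N, ∑ σ : Equiv.Perm (Fin (m + 1)), ∑ a : Fin m,
      (Equiv.Perm.sign σ : ℤ) * ((-1) ^ (a.castSucc.succ : ℕ) *
          g (fun l => kuhnVertex p σ (a.castSucc.succ.succAbove l))) = 0 := by
    refine Finset.sum_eq_zero fun p _ => ?_
    rw [Finset.sum_comm]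
    exact Finset.sum_eq_zero fun a _ => inner p a
  rw [mid, zero_add, Finset.sum_comm, Finset.sum_comm (s := latticeBox (m + 1) N)]
  simp only [Fin.succAbove_zero, Fin.succ_last, Fin.succAbove_last, Fin.val_zero, pow_zero,
    one_mul, Fin.val_last, Nat.succ_eq_add_one, pow_succ, neg_mul, mul_one, mul_neg,
    Finset.sum_neg_distrib]
  rw [ends, add_neg_cancel]

/-- The sum, over the simplices of the Kuhn triangulation of the cube `[0, N]ⁿ`, of the oriented
volumes (times `n!`) of their images under the simplexwise affine extension of `s`. -/
noncomputable def imageVolume {n : ℕ} (N : ℤ) (s : Fin n → (Fin n → ℤ) → ℤ) : ℤ :=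
  ∑ p ∈ latticeBox n N, ∑ σ : Equiv.Perm (Fin n), (Equiv.Perm.sign σ : ℤ) *
    (Matrix.of (Fin.cons 1 fun j k => s j (kuhnVertex p σ k)) :
      Matrix (Fin (n + 1)) (Fin (n + 1)) ℤ).det

lemma det_ones_update {m : ℕ} (S : Fin (m + 1) → Fin (m + 2) → ℤ) (i : Fin (m + 1))
    (u : Fin (m + 2) → ℤ) :
    (Matrix.of (Fin.cons 1 (Function.update S i u)) : Matrix (Fin (m + 2)) (Fin (m + 2)) ℤ).det
      = ∑ k : Fin (m + 2), (-1) ^ (k : ℕ) * ((∑ l, u (k.succAbove l)) *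
        (Matrix.of fun j l => Function.update S i 1 j (k.succAbove l) :
          Matrix (Fin (m + 1)) (Fin (m + 1)) ℤ).det) := by
  set U := ∑ k, u k with hU
  let B : Matrix (Fin (m + 2)) (Fin (m + 2)) ℤ := Matrix.of (Fin.cons u (Function.update S i 1))
  have h₁ : (Matrix.of (Fin.cons 1 (Function.update S i u)) :
      Matrix (Fin (m + 2)) (Fin (m + 2)) ℤ) = B.submatrix (Equiv.swap 0 i.succ) id := by
    ext j k
    refine Fin.cases ?_ (fun j => ?_) j
    · simp only [B, Matrix.submatrix_apply, Matrix.of_apply, Equiv.swap_apply_left, Fin.cons_zero,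
        Fin.cons_succ, Function.update_self, id]
    · by_cases hj : j = i
      · subst hj
        simp only [B, Matrix.submatrix_apply, Matrix.of_apply, Equiv.swap_apply_right,
          Fin.cons_zero, Fin.cons_succ, Function.update_self, id]
      · rw [Matrix.submatrix_apply, Equiv.swap_apply_of_ne_of_ne (Fin.succ_ne_zero _)
          (by simpa using hj)]
        simp only [B, Matrix.of_apply, Fin.cons_succ, Function.update_of_ne hj, id]
  have h₂ : (B.updateRow 0 ((-1 : ℤ) • B 0 + U • B i.succ)).det = -B.det := by
    have h₀ : (B.updateRow 0 (B i.succ)).det = 0 :=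
      Matrix.det_updateRow_eq_zero (Fin.succ_ne_zero i)
    rw [Matrix.det_updateRow_add, Matrix.det_updateRow_smul, Matrix.det_updateRow_smul,
      Matrix.updateRow_eq_self, h₀]
    simp
  rw [h₁, Matrix.det_permute, Equiv.Perm.sign_swap (Fin.succ_ne_zero i).symm]
  rw [Units.val_neg, Units.val_one, Int.cast_neg, Int.cast_one, neg_one_mul, ← h₂,
    Matrix.det_succ_row_zero]
  refine Finset.sum_congr rfl fun k _ => ?_
  have h₃ : ∑ l, u (k.succAbove l) = U - u k := by
    rw [hU, Fin.sum_univ_succAbove _ k]; ring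
  rw [h₃, mul_assoc]
  congr 2
  · have hB₀ : B 0 k = u k := rfl
    have hB₁ : B i.succ k = 1 := by
      simp only [B, Matrix.of_apply, Fin.cons_succ, Function.update_self, Pi.one_apply]
    rw [Matrix.updateRow_self, Pi.add_apply, Pi.smul_apply, Pi.smul_apply, hB₀, hB₁]
    simp only [smul_eq_mul]
    ring

/-- The boundary conditions making a map send opposite faces of `[0, N]ⁿ` to opposite faces. -/
def FaceCondition {n : ℕ} (N : ℤ) (i : Fin n) (f : (Fin n → ℤ) → ℤ) (c : ℤ) : Prop :=
  (∀ p, p i ≤ 0 → f p = 0) ∧ ∀ p, N ≤ p i → f p = c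

lemma imageVolume_update_eq_zero {m : ℕ} {N : ℤ} {s : Fin (m + 1) → (Fin (m + 1) → ℤ) → ℤ}
    (i : Fin (m + 1)) {u : (Fin (m + 1) → ℤ) → ℤ}
    (hs : ∀ j ≠ i, FaceCondition N j (s j) 1) (hu : FaceCondition N i u 0) :
    imageVolume N (Function.update s i u) = 0 := by
  have e : ∀ p σ, (fun j k => Function.update s i u j (kuhnVertex p σ k)) =
      Function.update (fun j k => s j (kuhnVertex p σ k)) i (fun k => u (kuhnVertex p σ k)) := by
    intro p σ
    funext j k
    by_cases hj : j = i
    · subst hj; simp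
    · simp [hj]
  unfold imageVolume
  simp only [e, det_ones_update]
  let g : (Fin (m + 1) → Fin (m + 1) → ℤ) → ℤ := fun w => (∑ l, u (w l)) *
    (Matrix.of fun j l => Function.update (fun j l => s j (w l)) i 1 j l :
      Matrix (Fin (m + 1)) (Fin (m + 1)) ℤ).det
  have hg : ∀ w, g w ≠ 0 → ∀ j, (∃ l, 0 < w l j) ∧ ∃ l, w l j < N := by
    intro w hw j
    have hw₁ := left_ne_zero_of_mul hw
    have hw₂ := right_ne_zero_of_mul hw
    by_cases hj : j = i
    · subst hj
      obtain ⟨l, -, hl⟩ := Finset.exists_ne_zero_of_sum_ne_zero hw₁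
      refine ⟨⟨l, ?_⟩, l, ?_⟩
      · by_contra! h; exact hl (hu.1 _ h)
      · by_contra! h; exact hl (hu.2 _ h)
    · constructor
      · by_contra! h
        refine hw₂ (Matrix.det_eq_zero_of_row_eq_zero j fun l => ?_)
        simp [hj, (hs j hj).1 _ (h l)]
      · by_contra! h
        refine hw₂ (Matrix.det_zero_of_row_eq hj ?_)
        funext l
        simp [hj, (hs j hj).2 _ (h l)]
  rw [← sum_faces_eq_zero hg]
  refine Finset.sum_congr rfl fun p _ => Finset.sum_congr rfl fun σ _ => ?_
  congr 1
  refine Finset.sum_congr rfl fun k _ => ?_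
  congr 3
  congr 1
  ext j l
  by_cases hj : j = i
  · subst hj; simp
  · simp [hj]

lemma imageVolume_update_add {n : ℕ} {N : ℤ} (s : Fin n → (Fin n → ℤ) → ℤ)
    (i : Fin n) (a b : (Fin n → ℤ) → ℤ) :
    imageVolume N (Function.update s i (a + b))
      = imageVolume N (Function.update s i a) + imageVolume N (Function.update s i b) := by
  unfold imageVolume
  simp only [← Finset.sum_add_distrib, ← mul_add]
  refine Finset.sum_congr rfl fun p _ => Finset.sum_congr rfl fun σ _ => ?_
  congr 1
  have e : ∀ f, (Matrix.of (Fin.cons 1 fun j k => Function.update s i f j (kuhnVertex p σ k)) :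
      Matrix (Fin (n + 1)) (Fin (n + 1)) ℤ) =
      (Matrix.of (Fin.cons 1 fun j k => s j (kuhnVertex p σ k)) :
        Matrix (Fin (n + 1)) (Fin (n + 1)) ℤ).updateRow i.succ
          (fun k => f (kuhnVertex p σ k)) := by
    intro f
    ext j k
    refine Fin.cases ?_ (fun j => ?_) j
    · rw [Matrix.updateRow_ne (Fin.succ_ne_zero i).symm]; simp
    · by_cases hj : j = i
      · subst hj; simp
      · rw [Matrix.updateRow_ne (by simpa using hj)]; simp [hj]
  rw [e, e, e, ← Matrix.det_updateRow_add]
  rfl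

lemma imageVolume_eq_of_faceCondition {m : ℕ} {N : ℤ}
    {s h : Fin (m + 1) → (Fin (m + 1) → ℤ) → ℤ}
    (hs : ∀ j, FaceCondition N j (s j) 1) (hh : ∀ j, FaceCondition N j (h j) 1) :
    imageVolume N s = imageVolume N h := by
  have key : ∀ S : Finset (Fin (m + 1)), imageVolume N (S.piecewise h s) = imageVolume N s := by
    intro S
    induction S using Finset.induction_on with
    | empty => simp
    | insert i S hi ih =>
      have e : h i = s i + (h i - s i) := by abel
      have hpc : ∀ j ≠ i, FaceCondition N j (S.piecewise h s j) 1 := by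
        intro j _
        by_cases hj : j ∈ S
        · simpa [hj] using hh j
        · simpa [hj] using hs j
      rw [Finset.piecewise_insert, e, imageVolume_update_add,
        imageVolume_update_eq_zero i hpc (u := h i - s i)
          ⟨fun p hp => by simp [(hh i).1 p hp, (hs i).1 p hp],
            fun p hp => by simp [(hh i).2 p hp, (hs i).2 p hp]⟩, add_zero]
      rw [show s i = S.piecewise h s i by simp [hi], Function.update_eq_self, ih]
  rw [← key Finset.univ, Finset.piecewise_univ]

lemma det_ones_step {n : ℕ} (σ : Equiv.Perm (Fin n)) :
    (Matrix.of (Fin.cons 1 fun j k => if (σ.symm j : ℕ) < (k : Fin (n + 1)) then 1 else 0) :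
      Matrix (Fin (n + 1)) (Fin (n + 1)) ℤ).det = Equiv.Perm.sign σ := by
  let A : Matrix (Fin (n + 1)) (Fin (n + 1)) ℤ := Matrix.of fun j k => if j ≤ k then 1 else 0
  have hA : A.det = 1 := by
    rw [Matrix.det_of_isUpperTriangular]
    · simp [A]
    · intro j k hjk
      simp only [id] at hjk
      simp [A, hjk]
  have e : (Matrix.of (Fin.cons 1 fun j k => if (σ.symm j : ℕ) < (k : Fin (n + 1)) then 1 else 0) :
      Matrix (Fin (n + 1)) (Fin (n + 1)) ℤ) =
      A.submatrix (Equiv.Perm.decomposeFin.symm (0, σ.symm)) id := by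
    ext j k
    refine Fin.cases ?_ (fun j => ?_) j
    · simp [A]
    · simp only [A, Matrix.submatrix_apply, Matrix.of_apply, Fin.cons_succ,
        Equiv.Perm.decomposeFin_symm_apply_succ, Fin.le_def, id]
      simp
  rw [e, Matrix.det_permute, hA, Equiv.Perm.decomposeFin.symm_sign]
  simp

lemma imageVolume_step {n : ℕ} {N : ℤ} (hN : 0 < N) :
    imageVolume N (fun (i : Fin n) p => if 0 < p i then 1 else 0) = n.factorial := by
  unfold imageVolume
  rw [Finset.sum_eq_single_of_mem (0 : Fin n → ℤ) (by simp [latticeBox, hN])]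
  · rw [Finset.sum_congr rfl (g := fun _ => (1 : ℤ))]
    · simp [Fintype.card_perm]
    · intro σ _
      have : (fun (j : Fin n) (k : Fin (n + 1)) => if 0 < kuhnVertex 0 σ k j then (1 : ℤ) else 0)
          = fun j (k : Fin (n + 1)) => if (σ.symm j : ℕ) < (k : ℕ) then 1 else 0 := by
        funext j k
        unfold kuhnVertex
        by_cases h : (σ.symm j : ℕ) < k <;> simp [h]
      rw [this, det_ones_step, ← Units.val_mul, Int.units_mul_self, Units.val_one]
  · intro p hp hp0
    obtain ⟨j, hj⟩ := Function.ne_iff.1 hp0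
    have hpj : 0 < p j := by
      simp only [latticeBox, Fintype.mem_piFinset, Finset.mem_Ico] at hp
      exact lt_of_le_of_ne (hp j).1 (Ne.symm hj)
    refine Finset.sum_eq_zero fun σ _ => ?_
    rw [Matrix.det_zero_of_row_eq (Fin.succ_ne_zero j).symm, mul_zero]
    funext k
    have := le_kuhnVertex p σ k j
    simp [hpj.trans_le this]

/-- A discrete form of the Poincaré–Miranda theorem. -/
theorem exists_cell_sign_change {m : ℕ} {N : ℤ} (hN : 0 < N)
    (F : (Fin (m + 1) → ℤ) → Fin (m + 1) → ℝ)
    (hlow : ∀ p i, (∀ j, 0 ≤ p j ∧ p j ≤ N) → p i = 0 → F p i ≤ 0)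
    (hhigh : ∀ p i, (∀ j, 0 ≤ p j ∧ p j ≤ N) → p i = N → 0 < F p i) :
    ∃ p : Fin (m + 1) → ℤ, (∀ j, 0 ≤ p j ∧ p j < N) ∧ ∀ i, ∃ q q' : Fin (m + 1) → ℤ,
      (∀ j, p j ≤ q j ∧ q j ≤ p j + 1) ∧ (∀ j, p j ≤ q' j ∧ q' j ≤ p j + 1) ∧
        F q i ≤ 0 ∧ 0 < F q' i := by
  let c : (Fin (m + 1) → ℤ) → Fin (m + 1) → ℤ := fun p j => max 0 (min (p j) N)
  have hc : ∀ p j, 0 ≤ c p j ∧ c p j ≤ N := fun p j => by simp only [c]; omega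
  let s : Fin (m + 1) → (Fin (m + 1) → ℤ) → ℤ := fun i p => if 0 < F (c p) i then 1 else 0
  have hs : ∀ j, FaceCondition N j (s j) 1 := by
    refine fun j => ⟨fun p hp => ?_, fun p hp => ?_⟩
    · exact if_neg (hlow _ _ (hc p) (by simp only [c]; omega)).not_gt
    · exact if_pos (hhigh _ _ (hc p) (by simp only [c]; omega))
  have hh : ∀ j : Fin (m + 1), FaceCondition N j (fun p => if 0 < p j then 1 else 0) 1 :=
    fun j => ⟨fun p hp => if_neg hp.not_gt, fun p hp => if_pos (hN.trans_le hp)⟩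
  have hne : imageVolume N s ≠ 0 := by
    rw [imageVolume_eq_of_faceCondition hs hh, imageVolume_step hN]
    exact_mod_cast Nat.factorial_ne_zero _
  obtain ⟨p, hp, hp'⟩ := Finset.exists_ne_zero_of_sum_ne_zero hne
  obtain ⟨σ, -, hσ⟩ := Finset.exists_ne_zero_of_sum_ne_zero hp'
  have hdet := right_ne_zero_of_mul hσ
  simp only [latticeBox, Fintype.mem_piFinset, Finset.mem_Ico] at hp
  have hcv : ∀ k, c (kuhnVertex p σ k) = kuhnVertex p σ k := by
    intro k
    funext j
    have h₁ := kuhnVertex_le p σ k j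
    have h₂ := le_kuhnVertex p σ k j
    have h₃ := hp j
    simp only [c]
    omega
  refine ⟨p, hp, fun i => ?_⟩
  have hq : ∃ k, F (kuhnVertex p σ k) i ≤ 0 := by
    by_contra! h
    refine hdet (Matrix.det_zero_of_row_eq (Fin.succ_ne_zero i).symm ?_)
    funext k
    simp [s, hcv, h k]
  have hq' : ∃ k, 0 < F (kuhnVertex p σ k) i := by
    by_contra! h
    refine hdet (Matrix.det_eq_zero_of_row_eq_zero i.succ fun k => ?_)
    simp [s, hcv, h k]
  obtain ⟨k, hk⟩ := hq
  obtain ⟨k', hk'⟩ := hq'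
  exact ⟨_, _, fun j => ⟨le_kuhnVertex p σ k j, kuhnVertex_le p σ k j⟩,
    fun j => ⟨le_kuhnVertex p σ k' j, kuhnVertex_le p σ k' j⟩, hk, hk'⟩

/-- Any two points of a preconnected set are joined by an `ε`-chain in it. -/
lemma IsPreconnected.exists_chain {E : Type*} [PseudoMetricSpace E] {K : Set E}
    (hK : IsPreconnected K) {a b : E} (ha : a ∈ K) (hb : b ∈ K) {ε : ℝ} (hε : 0 < ε) :
    ∃ (c : ℕ → E) (M : ℕ), c 0 = a ∧ (∀ k, M ≤ k → c k = b) ∧ (∀ k, c k ∈ K) ∧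
      ∀ k, dist (c k) (c (k + 1)) < ε := by
  let r : E → E → Prop := fun x y => x ∈ K ∧ y ∈ K ∧ dist x y < ε
  have hab : Relation.ReflTransGen r a b := by
    refine hK.induction₂' (Relation.ReflTransGen r) (fun x hx => ?_)
      (fun _ _ _ _ _ _ => Relation.ReflTransGen.trans) ha hb
    filter_upwards [self_mem_nhdsWithin, mem_nhdsWithin_of_mem_nhds (Metric.ball_mem_nhds x hε)]
      with y hy hxy
    exact ⟨Relation.ReflTransGen.single ⟨hx, hy, by rw [dist_comm]; exact hxy⟩,
      Relation.ReflTransGen.single ⟨hy, hx, hxy⟩⟩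
  clear hb
  induction hab with
  | refl => exact ⟨fun _ => a, 0, rfl, fun _ _ => rfl, fun _ => ha, fun _ => by simpa using hε⟩
  | @tail b z _ hbz ih =>
    obtain ⟨c, M, h₀, hM, hcK, hc⟩ := ih
    refine ⟨fun k => if k ≤ M then c k else z, M + 1, by simpa using h₀,
      fun k hk => if_neg (by omega), fun k => ?_, fun k => ?_⟩
    · dsimp only
      split_ifs
      exacts [hcK k, hbz.2.1]
    · dsimp only
      rcases lt_trichotomy k M with h | h | h
      · rw [if_pos h.le, if_pos (by omega)]; exact hc k
      · rw [if_pos h.le, if_neg (by omega), hM k h.ge]; exact hbz.2.2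
      · rw [if_neg (by omega), if_neg (by omega), dist_self]; exact hε

/-- The path `ℤ → E` which concatenates translates by multiples of `e` of the first `M` steps
of `c`, and is at `-l • e` at time `0`. -/
noncomputable def periodicPath {E : Type*} [AddCommGroup E] (c : ℕ → E) (e : E) (M l : ℕ)
    (t : ℤ) : E :=
  (t / M - l) • e + c (t % M).toNat

lemma norm_periodicPath_succ_sub_le {E : Type*} [SeminormedAddCommGroup E] {c : ℕ → E} {e : E}
    {M : ℕ} (hM : 0 < M) (l : ℕ) (h0 : c 0 = 0) (hcM : c M = e) {ε : ℝ}
    (hc : ∀ k, dist (c k) (c (k + 1)) < ε) (t : ℤ) :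
    ‖periodicPath c e M l (t + 1) - periodicPath c e M l t‖ ≤ ε := by
  obtain ⟨q, k, hk, rfl⟩ : ∃ (q : ℤ) (k : ℕ), k < M ∧ t = M * q + k := by
    have hM' : (0 : ℤ) < M := by exact_mod_cast hM
    have h₁ := Int.emod_nonneg t hM'.ne'
    have h₂ := Int.emod_lt_of_pos t hM'
    have h₃ := Int.mul_ediv_add_emod t M
    exact ⟨t / M, (t % M).toNat, by omega, by rw [Int.toNat_of_nonneg h₁, h₃]⟩
  have hval : ∀ (q : ℤ) (k : ℕ), k < M →
      periodicPath c e M l (M * q + k) = (q - l) • e + c k := by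
    intro q k hk
    have hM' : (M : ℤ) ≠ 0 := by exact_mod_cast hM.ne'
    have hk₁ : (k : ℤ) / M = 0 := Int.ediv_eq_zero_of_lt (by positivity) (by exact_mod_cast hk)
    have hk₂ : (k : ℤ) % M = k := Int.emod_eq_of_lt (by positivity) (by exact_mod_cast hk)
    simp [periodicPath, Int.mul_add_ediv_left _ _ hM', hk₁, hk₂]
  have hdist := (hc k).le
  rw [dist_comm, dist_eq_norm] at hdist
  rcases Nat.lt_or_ge (k + 1) M with h | h
  · rw [hval q k hk, show (M * q + k + 1 : ℤ) = M * q + (k + 1 : ℕ) by push_cast; ring,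
      hval q (k + 1) h, add_sub_add_left_eq_sub]
    exact hdist
  · have hkM : k + 1 = M := by omega
    have : (M * q + k + 1 : ℤ) = M * (q + 1) + (0 : ℕ) := by
      rw [← hkM]; push_cast; ring
    rw [hval q k hk, this, hval (q + 1) 0 hM, h0]
    rw [hkM, hcM] at hdist
    rwa [show (q + 1 - l) • e + 0 - ((q - l) • e + c k) = e - c k by
      rw [show q + 1 - (l : ℤ) = q - l + 1 by ring, add_smul, one_smul]; abel]

lemma isCompact_familySum {n : ℕ} {E : Type*} [TopologicalSpace E] [AddCommMonoid E]
    [ContinuousAdd E] {K : Fin n → Set E} (hK : ∀ i, IsCompact (K i)) :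
    IsCompact (familySum K) := by
  have : familySum K = (fun f : Fin n → E => ∑ i, f i) '' Set.univ.pi K := by
    ext x
    simp [familySum]
  rw [this]
  exact (isCompact_univ_pi hK).image (by fun_prop)

lemma finite_lattice_points (n l : ℕ) :
    {z : Fin n → ℝ | ∃ w : Fin n → ℤ, (∀ i, |w i| ≤ (l : ℤ)) ∧
      z = fun i => (w i : ℝ)}.Finite := by
  refine ((Fintype.piFinset fun _ : Fin n => Finset.Icc (-(l : ℤ)) l).finite_toSet.image
    fun w i => (w i : ℝ)).subset ?_
  rintro z ⟨w, hw, rfl⟩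
  exact ⟨w, by simpa [abs_le, Pi.le_def, forall_and] using hw, rfl⟩

lemma exists_mem_sum_near {m : ℕ} {K : Fin (m + 1) → Set (Fin (m + 1) → ℝ)}
    (hconn : ∀ i, IsConnected (K i))
    (h0 : ∀ i, (0 : Fin (m + 1) → ℝ) ∈ K i)
    (he : ∀ i, (Pi.single i 1 : Fin (m + 1) → ℝ) ∈ K i)
    {δ : ℝ} (hδ : ∀ i, ∀ x ∈ K i, ‖x‖ ≤ δ)
    {s : ℝ} {l : ℕ} (hl : 0 < l) (hsl : s + m * δ < l)
    {x : Fin (m + 1) → ℝ} (hx : ∀ i, |x i| ≤ s) {ε : ℝ} (hε : 0 < ε) :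
    ∃ y ∈ familySum K + {z : Fin (m + 1) → ℝ | ∃ w : Fin (m + 1) → ℤ,
      (∀ i, |w i| ≤ (l : ℤ)) ∧ z = fun i => (w i : ℝ)}, ‖y - x‖ ≤ (m + 1) * ε := by
  choose c M hc0 hcM hcK hc using fun i => (hconn i).isPreconnected.exists_chain (h0 i) (he i) hε
  obtain ⟨L, hL, hML⟩ : ∃ L : ℕ, 0 < L ∧ ∀ i, M i ≤ L :=
    ⟨∑ i, M i + 1, by omega, fun i =>
      (Finset.single_le_sum (fun _ _ => Nat.zero_le _) (Finset.mem_univ i)).trans (by omega)⟩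
  have hL' : (0 : ℤ) < L := by exact_mod_cast hL
  let γ : Fin (m + 1) → ℤ → Fin (m + 1) → ℝ := fun i =>
    periodicPath (c i) (Pi.single i 1) L l
  let Γ : (Fin (m + 1) → ℤ) → Fin (m + 1) → ℝ := fun p => ∑ i, γ i (p i)
  have hγ : ∀ i t, ‖γ i (t + 1) - γ i t‖ ≤ ε := fun i t =>
    norm_periodicPath_succ_sub_le hL l (hc0 i) (hcM i L (hML i)) (hc i) t
  have hstep : ∀ p q : Fin (m + 1) → ℤ, (∀ j, p j ≤ q j ∧ q j ≤ p j + 1) →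
      ‖Γ q - Γ p‖ ≤ (m + 1) * ε := by
    intro p q hpq
    simp only [Γ, ← Finset.sum_sub_distrib]
    refine (norm_sum_le_of_le (f := fun i => γ i (q i) - γ i (p i)) (n := fun _ => ε) Finset.univ
      fun i _ => ?_).trans (by simp)
    obtain h | h : q i = p i ∨ q i = p i + 1 := by have := hpq i; omega
    · simpa [h] using hε.le
    · rw [h]; exact hγ i _
  have hcoord : ∀ (p : Fin (m + 1) → ℤ) (i : Fin (m + 1)),
      |Γ p i - γ i (p i) i| ≤ m * δ := by
    intro p i
    have h₁ : Γ p i - γ i (p i) i = ∑ j ∈ Finset.univ.erase i, γ j (p j) i := by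
      simp only [Γ, Finset.sum_apply]
      rw [← Finset.add_sum_erase _ _ (Finset.mem_univ i)]
      ring
    rw [h₁, ← Real.norm_eq_abs]
    refine (norm_sum_le_of_le (n := fun _ => δ) _ fun j hj => ?_).trans (by simp)
    have hij : i ≠ j := (Finset.ne_of_mem_erase hj).symm
    have h₂ : γ j (p j) i = c j (p j % L).toNat i := by
      simp [γ, periodicPath, hij]
    rw [h₂]
    exact (norm_le_pi_norm _ i).trans (hδ j _ (hcK j _))
  have hsat := exists_cell_sign_change (N := 2 * l * L) (by positivity) (fun p => Γ p - x)
    (fun p i _ hp => by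
      have h₁ : γ i (p i) i = -l := by simp [γ, periodicPath, hp, hc0]
      have h₂ := abs_le.1 (hcoord p i)
      have h₃ := abs_le.1 (hx i)
      rw [h₁] at h₂
      rw [Pi.sub_apply]
      linarith)
    (fun p i _ hp => by
      have h₁ : γ i (p i) i = l := by
        simp [γ, periodicPath, hp, hc0, hL.ne']
        ring
      have h₂ := abs_le.1 (hcoord p i)
      have h₃ := abs_le.1 (hx i)
      rw [h₁] at h₂
      rw [Pi.sub_apply]
      linarith)
  obtain ⟨p, hp, hsign⟩ := hsat
  refine ⟨Γ p, ?_, ?_⟩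
  · refine Set.mem_add.2 ⟨∑ i, c i (p i % L).toNat, ⟨_, fun i => hcK i _, rfl⟩,
      fun i => ((p i / L - l : ℤ) : ℝ), ⟨fun i => p i / L - l, fun i => ?_, rfl⟩, ?_⟩
    · have h₁ : 0 ≤ p i / L := Int.ediv_nonneg (hp i).1 hL'.le
      have h₂ : p i / L < 2 * l := Int.ediv_lt_of_lt_mul hL' (hp i).2
      rw [abs_le]
      constructor <;> linarith
    · simp only [Γ, γ, periodicPath, Finset.sum_add_distrib]
      refine (add_comm _ _).trans (congrArg (· + _) ?_)
      funext j
      simp [Finset.sum_apply, Pi.single_apply]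
  · rw [pi_norm_le_iff_of_nonneg (by positivity)]
    intro i
    obtain ⟨q, q', hq, hq', h₁, h₂⟩ := hsign i
    have h₃ := abs_le.1 ((norm_le_pi_norm _ i).trans (hstep p q hq))
    have h₄ := abs_le.1 ((norm_le_pi_norm _ i).trans (hstep p q' hq'))
    simp only [Pi.sub_apply] at h₁ h₂ h₃ h₄ ⊢
    rw [Real.norm_eq_abs, abs_le]
    constructor <;> linarith

theorem cube_subset_sum_add_lattice
    {n : ℕ} (hn : 0 < n) (K : Fin n → Set (Fin n → ℝ))
    (hne : ∀ i, (K i).Nonempty)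
    (hcomp : ∀ i, IsCompact (K i))
    (hconn : ∀ i, IsConnected (K i))
    (h0 : ∀ i, (0 : Fin n → ℝ) ∈ K i)
    (he : ∀ i, (Pi.single i 1 : Fin n → ℝ) ∈ K i)
    (δ : ℝ) (hδ0 : 0 ≤ δ) (hδ : ∀ i, ∀ x ∈ K i, ‖x‖ ≤ δ)
    (s l : ℕ) (hs : 0 < s) (hl : 0 < l)
    (hsl : (s : ℝ) + (n - 1 : ℝ) * δ < l) :
    {x : Fin n → ℝ | ∀ i, |x i| ≤ (s : ℝ)} ⊆
      familySum K + {z : Fin n → ℝ | ∃ w : Fin n → ℤ, (∀ i, |w i| ≤ (l : ℤ)) ∧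
        z = fun i => (w i : ℝ)} := by
  obtain ⟨m, rfl⟩ := Nat.exists_eq_succ_of_ne_zero hn.ne'
  intro x hx
  have hclosed := ((isCompact_familySum hcomp).add
    (finite_lattice_points (m + 1) l).isCompact).isClosed
  refine hclosed.closure_subset (Metric.mem_closure_iff.2 fun ε hε => ?_)
  have hm : (0 : ℝ) < m + 1 := by positivity
  obtain ⟨y, hy, hyx⟩ := exists_mem_sum_near hconn h0 he hδ hl (by simpa using hsl) hx
    (ε := ε / (2 * (m + 1))) (by positivity)
  refine ⟨y, hy, ?_⟩
  rw [dist_comm, dist_eq_norm]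
  have : (m + 1) * (ε / (2 * (m + 1))) = ε / 2 := by field_simp
  linarith
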